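/- Let p ∈ (0,1) be constant and b = 1/(1−p). For every ε > 0 there is n₀ such that for all n ≥ n₀ and every integer a = a(n) satisfying 1.01 log_b n ≤ a ≤ 100 log_b n and μ ≤ n^{1.99}, where μ = binom(n,a)(1−p)^{binom(a,2)}, there is a coupling of the random graphs G_n = G_{n,p} and G_{n−a} = G_{n−a,p} with the property that P(χ(G_n) ≤ χ(G_{n−a}) + 1) ≥ 1 − (1+ε)/(2√μ). -/

import Mathlib

open Filter Real

/-- Number of edges of a graph on `Fin n`. -/
noncomputable def edgeCount {n : ℕ} (G : SimpleGraph (Fin n)) : ℕ := G.edgeSet.ncard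

/-- The probability that the binomial random graph `G_{n,p}` equals `G`. -/
noncomputable def gnpWeight (n : ℕ) (p : ℝ) (G : SimpleGraph (Fin n)) : ℝ :=
  p ^ edgeCount G * (1 - p) ^ (n.choose 2 - edgeCount G)

/-- The chromatic number, as a natural number. -/
noncomputable def chrom {n : ℕ} (G : SimpleGraph (Fin n)) : ℕ := G.chromaticNumber.toNat

/-- `μ_a(n) = C(n,a) q^C(a,2)` where `q = 1-p`. -/
noncomputable def muNat (n a : ℕ) (q : ℝ) : ℝ := (n.choose a : ℝ) * q ^ a.choose 2

/-- A coupling of the random graphs `G_{n,p}` and `G_{m,p}`: a joint distribution on pairs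
of graphs whose marginals are `G_{n,p}` and `G_{m,p}`. -/
structure Coupling (p : ℝ) (n m : ℕ) where
  w : SimpleGraph (Fin n) × SimpleGraph (Fin m) → ℝ
  nonneg : ∀ x, 0 ≤ w x
  margFst : ∀ G : SimpleGraph (Fin n), (∑ H : SimpleGraph (Fin m), w (G, H)) = gnpWeight n p G
  margSnd : ∀ H : SimpleGraph (Fin m), (∑ G : SimpleGraph (Fin n), w (G, H)) = gnpWeight m p H

open scoped Classical in
/-- The probability of an event under a coupling. -/
noncomputable def couplingProb {p : ℝ} {n m : ℕ} (c : Coupling p n m)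
    (E : Set (SimpleGraph (Fin n) × SimpleGraph (Fin m))) : ℝ :=
  ∑ x : SimpleGraph (Fin n) × SimpleGraph (Fin m), if x ∈ E then c.w x else 0

/-- The pairs of distinct elements of `A`. -/
def pairsIn {V : Type*} [DecidableEq V] (A : Finset V) : Finset (Sym2 V) :=
  A.offDiag.image Sym2.mk.uncurry

theorem mk_mem_pairsIn {V : Type*} [DecidableEq V] {A : Finset V} {x y : V} :
    s(x, y) ∈ pairsIn A ↔ x ∈ A ∧ y ∈ A ∧ x ≠ y := by
  simp only [pairsIn, Finset.mem_image, Finset.mem_offDiag, Prod.exists]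
  constructor
  · rintro ⟨u, v, h, huv⟩
    rcases Sym2.eq_iff.1 huv with ⟨rfl, rfl⟩ | ⟨rfl, rfl⟩
    · exact h
    · exact ⟨h.2.1, h.1, h.2.2.symm⟩
  · exact fun h => ⟨x, y, h, rfl⟩

theorem card_pairsIn {V : Type*} [DecidableEq V] (A : Finset V) :
    (pairsIn A).card = A.card.choose 2 :=
  Sym2.card_image_offDiag A

theorem pairsIn_inter {V : Type*} [DecidableEq V] (A B : Finset V) :
    pairsIn A ∩ pairsIn B = pairsIn (A ∩ B) := by
  ext e
  induction e using Sym2.ind with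
  | _ x y => simp only [Finset.mem_inter, mk_mem_pairsIn]; tauto

theorem pairsIn_mono {V : Type*} [DecidableEq V] {A B : Finset V} (h : A ⊆ B) :
    pairsIn A ⊆ pairsIn B :=
  Finset.image_subset_image (Finset.offDiag_mono h)

theorem card_pairsIn_union {V : Type*} [DecidableEq V] (A B : Finset V) :
    (pairsIn A ∪ pairsIn B).card + (A ∩ B).card.choose 2
      = A.card.choose 2 + B.card.choose 2 := by
  rw [← card_pairsIn, ← pairsIn_inter, Finset.card_union_add_card_inter, card_pairsIn,
    card_pairsIn]

/-- Binomial mass of the subsets of `E` with prescribed trace `F₀` on `D`. -/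
theorem sum_powerset_trace {ι : Type*} [DecidableEq ι] {E D F₀ : Finset ι} (hD : D ⊆ E)
    (hF : F₀ ⊆ D) (p : ℝ) :
    ∑ F ∈ E.powerset with F ∩ D = F₀, p ^ F.card * (1 - p) ^ (E.card - F.card)
      = p ^ F₀.card * (1 - p) ^ (D.card - F₀.card) := by
  have h1 : ∑ F ∈ E.powerset with F ∩ D = F₀, p ^ F.card * (1 - p) ^ (E.card - F.card)
      = ∑ F ∈ (E \ D).powerset, p ^ F₀.card * (1 - p) ^ (D.card - F₀.card) *
        (p ^ F.card * (1 - p) ^ ((E \ D).card - F.card)) := by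
    symm
    refine Finset.sum_nbij' (fun F => F₀ ∪ F) (fun F => F \ D) ?_ ?_ ?_ ?_ ?_
    · intro F hF'
      simp only [Finset.mem_powerset, Finset.mem_filter] at *
      constructor
      · intro x; grind
      · ext x; grind
    · intro F hF'
      simp only [Finset.mem_powerset, Finset.mem_filter] at *
      grind
    · intro F hF'
      simp only [Finset.mem_powerset] at *
      ext x; grind
    · intro F hF'
      simp only [Finset.mem_powerset, Finset.mem_filter] at *
      ext x; grind
    · intro F hF'
      simp only [Finset.mem_powerset] at *
      have hd : Disjoint F₀ F := by
        rw [Finset.disjoint_left]; grind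
      have h2 := Finset.card_le_card hF
      have h3 := Finset.card_le_card hF'
      have h4 := Finset.card_sdiff_add_card_eq_card hD
      rw [Finset.card_union_of_disjoint hd, pow_add,
        show E.card - (F₀.card + F.card) = (D.card - F₀.card) + ((E \ D).card - F.card) by omega,
        pow_add]
      ring
  rw [h1, ← Finset.mul_sum, Finset.sum_pow_mul_eq_add_pow]
  simp

/-- The edges of a finite graph. -/
noncomputable def graphEdges {V : Type*} [Fintype V] (G : SimpleGraph V) : Finset (Sym2 V) :=
  G.edgeSet.toFinite.toFinset

theorem mem_graphEdges {V : Type*} [Fintype V] {G : SimpleGraph V} {e : Sym2 V} :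
    e ∈ graphEdges G ↔ e ∈ G.edgeSet :=
  Set.Finite.mem_toFinset _

theorem coe_graphEdges {V : Type*} [Fintype V] (G : SimpleGraph V) :
    (graphEdges G : Set (Sym2 V)) = G.edgeSet := by
  ext e
  exact mem_graphEdges

theorem edgeCount_eq_card {n : ℕ} (G : SimpleGraph (Fin n)) :
    edgeCount G = (graphEdges G).card := by
  rw [edgeCount, ← coe_graphEdges, Set.ncard_coe_finset]

theorem mem_pairsIn_univ {V : Type*} [DecidableEq V] [Fintype V] {e : Sym2 V} :
    e ∈ pairsIn Finset.univ ↔ ¬ e.IsDiag := by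
  induction e using Sym2.ind with
  | _ x y => simp [mk_mem_pairsIn]

theorem graphEdges_subset_pairsIn {V : Type*} [Fintype V] [DecidableEq V] (G : SimpleGraph V) :
    graphEdges G ⊆ pairsIn Finset.univ := by
  intro e he
  rw [mem_pairsIn_univ]
  exact G.not_isDiag_of_mem_edgeSet (mem_graphEdges.1 he)

theorem edgeCount_le {n : ℕ} (G : SimpleGraph (Fin n)) : edgeCount G ≤ n.choose 2 := by
  rw [edgeCount_eq_card]
  refine (Finset.card_le_card (graphEdges_subset_pairsIn G)).trans_eq ?_
  rw [card_pairsIn, Finset.card_univ, Fintype.card_fin]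

open scoped Classical in
/-- The probability that `G_{n,p}` has prescribed edge set `F₀` on the set `D` of pairs. -/
theorem sum_gnpWeight_trace {n : ℕ} {D F₀ : Finset (Sym2 (Fin n))}
    (hD : D ⊆ pairsIn Finset.univ) (hF : F₀ ⊆ D) (p : ℝ) :
    ∑ G : SimpleGraph (Fin n), (if graphEdges G ∩ D = F₀ then gnpWeight n p G else 0)
      = p ^ F₀.card * (1 - p) ^ (D.card - F₀.card) := by
  rw [← sum_powerset_trace hD hF, ← Finset.sum_filter]
  have hfrom : ∀ F ⊆ pairsIn (Finset.univ : Finset (Fin n)),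
      graphEdges (SimpleGraph.fromEdgeSet (F : Set (Sym2 (Fin n)))) = F := by
    intro F hFE
    ext e
    have := fun h => mem_pairsIn_univ.1 (@hFE e h)
    simp only [mem_graphEdges, SimpleGraph.edgeSet_fromEdgeSet, Set.mem_sdiff,
      Finset.mem_coe, Sym2.mem_diagSet]
    tauto
  refine Finset.sum_nbij' (fun G => graphEdges G)
    (fun F => SimpleGraph.fromEdgeSet (F : Set (Sym2 (Fin n)))) ?_ ?_ ?_ ?_ ?_
  · intro G hG
    simp only [Finset.mem_filter, Finset.mem_univ, true_and, Finset.mem_powerset] at *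
    exact ⟨graphEdges_subset_pairsIn G, hG⟩
  · intro F hF'
    simp only [Finset.mem_filter, Finset.mem_univ, true_and, Finset.mem_powerset] at *
    rw [hfrom F hF'.1]
    exact hF'.2
  · intro G _
    rw [coe_graphEdges, SimpleGraph.fromEdgeSet_edgeSet]
  · intro F hF'
    simp only [Finset.mem_filter, Finset.mem_powerset] at hF'
    exact hfrom F hF'.1
  · intro G _
    rw [gnpWeight, edgeCount_eq_card, card_pairsIn, Finset.card_univ, Fintype.card_fin]

theorem sum_gnpWeight (n : ℕ) (p : ℝ) : ∑ G : SimpleGraph (Fin n), gnpWeight n p G = 1 := by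
  classical
  simpa using sum_gnpWeight_trace (n := n) (Finset.empty_subset _) (Finset.Subset.refl ∅) p

theorem isIndepSet_iff_graphEdges {V : Type*} [Fintype V] [DecidableEq V]
    (G : SimpleGraph V) (A : Finset V) :
    G.IsIndepSet A ↔ graphEdges G ∩ pairsIn A = ∅ := by
  rw [Finset.eq_empty_iff_forall_notMem]
  constructor
  · intro h e
    induction e using Sym2.ind with
    | _ x y =>
      simp only [Finset.mem_inter, mem_graphEdges, SimpleGraph.mem_edgeSet,
        mk_mem_pairsIn]
      rintro ⟨h1, h2, h3, h4⟩
      exact h h2 h3 h4 h1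
  · intro h x hx y hy hxy hadj
    refine h s(x, y) ?_
    simp only [Finset.mem_inter, mem_graphEdges, SimpleGraph.mem_edgeSet,
        mk_mem_pairsIn]
    exact ⟨hadj, hx, hy, hxy⟩

open scoped Classical in
theorem sum_gnpWeight_isIndepSet {n : ℕ} (A : Finset (Fin n)) (p : ℝ) :
    ∑ G : SimpleGraph (Fin n), (if G.IsIndepSet A then gnpWeight n p G else 0)
      = (1 - p) ^ A.card.choose 2 := by
  simp_rw [isIndepSet_iff_graphEdges]
  rw [sum_gnpWeight_trace (pairsIn_mono (Finset.subset_univ A)) (Finset.empty_subset _),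
    card_pairsIn]
  simp

open scoped Classical in
theorem sum_gnpWeight_isIndepSet_pair {n : ℕ} (A B : Finset (Fin n)) (p : ℝ) :
    ∑ G : SimpleGraph (Fin n), (if G.IsIndepSet A ∧ G.IsIndepSet B then gnpWeight n p G else 0)
      = (1 - p) ^ (A.card.choose 2 + B.card.choose 2 - (A ∩ B).card.choose 2) := by
  have h : ∀ G : SimpleGraph (Fin n), (G.IsIndepSet A ∧ G.IsIndepSet B) ↔
      graphEdges G ∩ (pairsIn A ∪ pairsIn B) = ∅ := by
    intro G
    rw [isIndepSet_iff_graphEdges, isIndepSet_iff_graphEdges, Finset.inter_union_distrib_left,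
      Finset.union_eq_empty]
  simp_rw [h]
  rw [sum_gnpWeight_trace (Finset.union_subset (pairsIn_mono (Finset.subset_univ A))
    (pairsIn_mono (Finset.subset_univ B))) (Finset.empty_subset _), ← card_pairsIn_union]
  simp

open scoped Classical in
/-- Given that `A` is independent, the graph off `A` is distributed as `G_{n-a,p}`. -/
theorem sum_gnpWeight_isIndepSet_comap {n m : ℕ} (A : Finset (Fin n)) (e : Fin m ↪ Fin n)
    (he : Set.range e = (A : Set (Fin n))ᶜ) (H : SimpleGraph (Fin m)) (p : ℝ) :
    ∑ G : SimpleGraph (Fin n), (if G.IsIndepSet A ∧ G.comap e = H then gnpWeight n p G else 0)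
      = (1 - p) ^ A.card.choose 2 * gnpWeight m p H := by
  have hmem : ∀ x, e x ∉ A := by
    intro x
    have : e x ∈ (A : Set (Fin n))ᶜ := he ▸ Set.mem_range_self x
    simpa using this
  have hex : ∀ y, y ∉ A → ∃ x, e x = y := by
    intro y hy
    have : y ∈ Set.range e := by rw [he]; simpa using hy
    exact this
  have hFsub : (graphEdges H).map e.sym2Map ⊆ pairsIn Aᶜ := by
    intro z hz
    obtain ⟨w, hw, rfl⟩ := Finset.mem_map.1 hz
    clear hz
    induction w using Sym2.ind with
    | _ x y =>
      rw [mem_graphEdges, SimpleGraph.mem_edgeSet] at hw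
      change s(e x, e y) ∈ _
      rw [mk_mem_pairsIn, Finset.mem_compl, Finset.mem_compl]
      exact ⟨hmem x, hmem y, fun h => hw.ne (e.injective h)⟩
  have hmapmem : ∀ x y, s(e x, e y) ∈ (graphEdges H).map e.sym2Map ↔ H.Adj x y := by
    intro x y
    change e.sym2Map s(x, y) ∈ _ ↔ _
    rw [Finset.mem_map', mem_graphEdges, SimpleGraph.mem_edgeSet]
  have hiff : ∀ G : SimpleGraph (Fin n), (G.IsIndepSet A ∧ G.comap e = H) ↔
      graphEdges G ∩ (pairsIn A ∪ pairsIn Aᶜ) = (graphEdges H).map e.sym2Map := by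
    intro G
    constructor
    · rintro ⟨h1, h2⟩
      rw [isIndepSet_iff_graphEdges] at h1
      rw [Finset.inter_union_distrib_left, h1, Finset.empty_union]
      ext z
      induction z using Sym2.ind with
      | _ u v =>
        rw [Finset.mem_inter, mk_mem_pairsIn, mem_graphEdges, SimpleGraph.mem_edgeSet,
          Finset.mem_compl, Finset.mem_compl]
        constructor
        · rintro ⟨hadj, hu, hv, -⟩
          obtain ⟨x, rfl⟩ := hex u hu
          obtain ⟨y, rfl⟩ := hex v hv
          rw [hmapmem, ← h2]
          exact hadj
        · intro hz
          have h3 := hFsub hz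
          rw [mk_mem_pairsIn, Finset.mem_compl, Finset.mem_compl] at h3
          obtain ⟨x, rfl⟩ := hex u h3.1
          obtain ⟨y, rfl⟩ := hex v h3.2.1
          rw [hmapmem, ← h2] at hz
          exact ⟨hz, h3⟩
    · intro h
      have hz : ∀ z, z ∈ graphEdges G ∩ (pairsIn A ∪ pairsIn Aᶜ) ↔
        z ∈ (graphEdges H).map e.sym2Map := fun z => by rw [h]
      constructor
      · intro u hu v hv huv hadj
        have h3 := hFsub ((hz s(u, v)).1 (Finset.mem_inter.2
          ⟨mem_graphEdges.2 hadj, Finset.mem_union_left _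
            (mk_mem_pairsIn.2 ⟨hu, hv, huv⟩)⟩))
        rw [mk_mem_pairsIn, Finset.mem_compl] at h3
        exact h3.1 hu
      · ext x y
        rw [← hmapmem, ← hz, Finset.mem_inter, mem_graphEdges, SimpleGraph.mem_edgeSet,
          SimpleGraph.comap_adj, Finset.mem_union, mk_mem_pairsIn, mk_mem_pairsIn,
          Finset.mem_compl, Finset.mem_compl]
        constructor
        · intro hadj
          exact ⟨hadj, Or.inr ⟨hmem x, hmem y, hadj.ne⟩⟩
        · exact fun h => h.1
  simp_rw [hiff]
  have hcc : (Aᶜ).card = m := by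
    have h1 : (Aᶜ : Finset (Fin n)) = Finset.univ.map e := by
      ext y
      rw [Finset.mem_compl, Finset.mem_map]
      constructor
      · intro hy
        obtain ⟨x, hx⟩ := hex y hy
        exact ⟨x, Finset.mem_univ _, hx⟩
      · rintro ⟨x, -, rfl⟩
        exact hmem x
    rw [h1, Finset.card_map, Finset.card_univ, Fintype.card_fin]
  have hcard := card_pairsIn_union A Aᶜ
  rw [Finset.inter_compl, Finset.card_empty, hcc] at hcard
  simp only [Nat.choose_zero_succ, add_zero] at hcard
  rw [sum_gnpWeight_trace (Finset.union_subset (pairsIn_mono (Finset.subset_univ _))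
    (pairsIn_mono (Finset.subset_univ _))) (hFsub.trans Finset.subset_union_right),
    hcard, Finset.card_map, ← edgeCount_eq_card, Nat.add_sub_assoc (edgeCount_le H), pow_add,
    gnpWeight]
  ring

/-- A subcoupling of two finite distributions extends to a coupling. -/
theorem exists_coupling_ge {α β : Type*} [Fintype α] [Fintype β] (u : α → ℝ) (v : β → ℝ)
    (hu : ∑ x, u x = 1) (hv : ∑ y, v y = 1) (s : α → β → ℝ) (hs : ∀ x y, 0 ≤ s x y)
    (hsu : ∀ x, ∑ y, s x y ≤ u x) (hsv : ∀ y, ∑ x, s x y ≤ v y) :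
    ∃ c : α → β → ℝ, (∀ x y, s x y ≤ c x y) ∧ (∀ x y, 0 ≤ c x y) ∧
      (∀ x, ∑ y, c x y = u x) ∧ (∀ y, ∑ x, c x y = v y) := by
  set d : ℝ := 1 - ∑ x, ∑ y, s x y with hd
  have hd1 : ∑ x, (u x - ∑ y, s x y) = d := by rw [Finset.sum_sub_distrib, hu]
  have hd2 : ∑ y, (v y - ∑ x, s x y) = d := by
    rw [Finset.sum_sub_distrib, hv, Finset.sum_comm]
  have h1 : ∀ x, 0 ≤ u x - ∑ y, s x y := fun x => sub_nonneg.2 (hsu x)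
  have h2 : ∀ y, 0 ≤ v y - ∑ x, s x y := fun y => sub_nonneg.2 (hsv y)
  have hd0 : 0 ≤ d := hd1 ▸ Finset.sum_nonneg fun x _ => h1 x
  have hge : ∀ x y, s x y ≤ s x y + (u x - ∑ y, s x y) * (v y - ∑ x, s x y) / d :=
    fun x y => le_add_of_nonneg_right (div_nonneg (mul_nonneg (h1 x) (h2 y)) hd0)
  refine ⟨_, hge, fun x y => (hs x y).trans (hge x y), ?_, ?_⟩
  · intro x
    rw [Finset.sum_add_distrib, ← Finset.sum_div, ← Finset.mul_sum, hd2]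
    rcases eq_or_ne d 0 with h | h
    · have := (Finset.sum_eq_zero_iff_of_nonneg fun x _ => h1 x).1 (hd1.trans h) x
        (Finset.mem_univ _)
      rw [h, div_zero]; linarith
    · field_simp; ring
  · intro y
    rw [Finset.sum_add_distrib, ← Finset.sum_div, ← Finset.sum_mul, hd1]
    rcases eq_or_ne d 0 with h | h
    · have := (Finset.sum_eq_zero_iff_of_nonneg fun y _ => h2 y).1 (hd2.trans h) y
        (Finset.mem_univ _)
      rw [h, div_zero]; linarith
    · field_simp; ring

/-- Deleting an independent set lowers the chromatic number by at most one. -/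
theorem chrom_le_of_isIndepSet {n m : ℕ} (G : SimpleGraph (Fin n)) (A : Finset (Fin n))
    (hA : G.IsIndepSet A) (e : Fin m ↪ Fin n) (he : Set.range e = (A : Set (Fin n))ᶜ) :
    chrom G ≤ chrom (G.comap e) + 1 := by
  classical
  set H := G.comap e
  have hcol : H.Colorable (chrom H) := by
    have h : H.chromaticNumber ≠ ⊤ :=
      SimpleGraph.chromaticNumber_ne_top_iff_exists.2 ⟨_, H.colorable_of_fintype⟩
    exact SimpleGraph.chromaticNumber_le_iff_colorable.1 (ENat.natCast_toNat h).ge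
  obtain ⟨C⟩ := hcol
  have hex : ∀ y, y ∉ A → ∃ x, e x = y := by
    intro y hy
    have : y ∈ Set.range e := by rw [he]; simpa using hy
    exact this
  choose f hf using hex
  let C' : G.Coloring (Option (Fin (chrom H))) := SimpleGraph.Coloring.mk
    (fun y => if hy : y ∈ A then none else some (C (f y hy))) (by
      intro u v huv
      by_cases hu : u ∈ A <;> by_cases hv : v ∈ A
      · exact absurd huv (hA hu hv huv.ne)
      · simp [hu, hv]
      · simp [hu, hv]
      · simp only [hu, hv, dite_false, ne_eq, Option.some.injEq]
        refine C.valid ?_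
        rw [SimpleGraph.comap_adj, hf, hf]
        exact huv)
  have h := C'.colorable
  rw [Fintype.card_option, Fintype.card_fin] at h
  exact ENat.toNat_le_of_le_natCast h.chromaticNumber_le

/-- A bound on the number of `a`-sets meeting a given `a`-set in exactly `j` points. -/
theorem card_powersetCard_inter_le {n a j : ℕ} (A : Finset (Fin n)) (hA : A.card = a) :
    (((Finset.univ : Finset (Fin n)).powersetCard a).filter
      fun B => (A ∩ B).card = j).card ≤ a.choose j * (n - a).choose (a - j) := by
  have h : a.choose j * (n - a).choose (a - j) =
      (A.powersetCard j ×ˢ (Aᶜ).powersetCard (a - j)).card := by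
    rw [Finset.card_product, Finset.card_powersetCard, Finset.card_powersetCard,
      Finset.card_compl, hA, Fintype.card_fin]
  rw [h]
  refine Finset.card_le_card_of_injOn (fun B => (A ∩ B, B \ A)) ?_ ?_
  · intro B hB
    simp only [Finset.coe_filter, Finset.mem_powersetCard, Finset.subset_univ, true_and,
      Set.mem_ofPred_eq] at hB
    simp only [Finset.coe_product, Set.mem_prod, Finset.mem_coe, Finset.mem_powersetCard]
    refine ⟨⟨Finset.inter_subset_left, hB.2⟩, ?_, ?_⟩
    · intro x; simp
    · have := Finset.card_sdiff_add_card_inter B A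
      rw [Finset.inter_comm] at this
      omega
  · intro B _ B' _ h
    simp only [Prod.mk.injEq] at h
    ext x
    have h1 := Finset.ext_iff.1 h.1 x
    have h2 := Finset.ext_iff.1 h.2 x
    simp only [Finset.mem_inter, Finset.mem_sdiff] at h1 h2
    tauto

/-- If `X` has mean `μ` and variance at most `μ c²`, then size-biasing by `X` moves mass at most
`c / (2 √μ)`. -/
theorem one_sub_le_sum_div_max {Ω : Type*} [Fintype Ω] (w X : Ω → ℝ) (hw : ∀ ω, 0 ≤ w ω)
    (hw1 : ∑ ω, w ω = 1) {μ c : ℝ} (hμ : 0 < μ) (hc : 0 < c)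
    (hX : ∑ ω, w ω * X ω = μ) (hX2 : ∑ ω, w ω * X ω ^ 2 ≤ μ ^ 2 + μ * c ^ 2) :
    1 - c / (2 * √μ) ≤ ∑ ω, w ω * (X ω / max μ (X ω)) := by
  have hsq : 0 < √μ := Real.sqrt_pos.2 hμ
  set t : ℝ := c / √μ with ht
  have ht0 : 0 < t := div_pos hc hsq
  have ht2 : t ^ 2 = c ^ 2 / μ := by rw [ht, div_pow, Real.sq_sqrt hμ.le]
  have hpt : ∀ ω, (X ω / μ + 1 - (t + (X ω / μ - 1) ^ 2 / t) / 2) / 2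
      ≤ X ω / max μ (X ω) := by
    intro ω
    have habs : |X ω / μ - 1| ≤ (t + (X ω / μ - 1) ^ 2 / t) / 2 := by
      rw [← sq_abs (X ω / μ - 1)]
      set y := |X ω / μ - 1|
      have : (t + y ^ 2 / t) / 2 - y = (t - y) ^ 2 / (2 * t) := by field_simp; ring
      have h2 : 0 ≤ (t - y) ^ 2 / (2 * t) := by positivity
      linarith
    rcases le_total μ (X ω) with h | h
    · rw [max_eq_right h, div_self (hμ.trans_le h).ne']
      have := le_abs_self (X ω / μ - 1)
      linarith
    · rw [max_eq_left h]
      have := neg_abs_le (X ω / μ - 1)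
      linarith
  have hsum : ∑ ω, w ω * ((X ω / μ + 1 - (t + (X ω / μ - 1) ^ 2 / t) / 2) / 2)
      = 1 - (t + ((∑ ω, w ω * X ω ^ 2) / μ ^ 2 - 1) / t) / 4 := by
    have h1 : ∀ ω, w ω * ((X ω / μ + 1 - (t + (X ω / μ - 1) ^ 2 / t) / 2) / 2)
        = (w ω * X ω) * (1 / (2 * μ) + 1 / (2 * t * μ)) + w ω * (1 / 2 - t / 4 - 1 / (4 * t))
          - (w ω * X ω ^ 2) * (1 / (4 * t * μ ^ 2)) := by
      intro ω; field_simp; ring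
    simp_rw [h1]
    rw [Finset.sum_sub_distrib, Finset.sum_add_distrib, ← Finset.sum_mul, ← Finset.sum_mul,
      ← Finset.sum_mul, hX, hw1]
    field_simp
    ring
  have hV : (∑ ω, w ω * X ω ^ 2) / μ ^ 2 - 1 ≤ t ^ 2 := by
    rw [ht2, sub_le_iff_le_add, div_le_iff₀ (by positivity)]
    refine hX2.trans_eq ?_
    field_simp
    ring
  have hV' : ((∑ ω, w ω * X ω ^ 2) / μ ^ 2 - 1) / t ≤ t := by
    rw [div_le_iff₀ ht0]; linarith
  have hfin : c / (2 * √μ) = t / 2 := by rw [ht]; field_simp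
  calc 1 - c / (2 * √μ) ≤ 1 - (t + ((∑ ω, w ω * X ω ^ 2) / μ ^ 2 - 1) / t) / 4 := by
        rw [hfin]; linarith
    _ ≤ _ := by
        rw [← hsum]
        exact Finset.sum_le_sum fun ω _ => mul_le_mul_of_nonneg_left (hpt ω) (hw ω)

theorem gnpWeight_nonneg {n : ℕ} {p : ℝ} (hp0 : 0 ≤ p) (hp1 : p ≤ 1) (G : SimpleGraph (Fin n)) :
    0 ≤ gnpWeight n p G :=
  mul_nonneg (pow_nonneg hp0 _) (pow_nonneg (sub_nonneg.2 hp1) _)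

open scoped Classical in
/-- The number of independent sets of size `a`. -/
noncomputable def indepCount {n : ℕ} (a : ℕ) (G : SimpleGraph (Fin n)) : ℝ :=
  ∑ A ∈ (Finset.univ : Finset (Fin n)).powersetCard a, if G.IsIndepSet A then 1 else 0

theorem indepCount_nonneg {n : ℕ} (a : ℕ) (G : SimpleGraph (Fin n)) : 0 ≤ indepCount a G :=
  Finset.sum_nonneg fun A _ => by split_ifs <;> norm_num

theorem sum_gnpWeight_mul_indepCount (n a : ℕ) (p : ℝ) :
    ∑ G : SimpleGraph (Fin n), gnpWeight n p G * indepCount a G = muNat n a (1 - p) := by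
  classical
  simp_rw [indepCount, Finset.mul_sum, mul_ite, mul_one, mul_zero]
  rw [Finset.sum_comm]
  have h : ∀ A ∈ (Finset.univ : Finset (Fin n)).powersetCard a,
      ∑ G : SimpleGraph (Fin n), (if G.IsIndepSet A then gnpWeight n p G else 0)
        = (1 - p) ^ a.choose 2 := by
    intro A hA
    rw [← (Finset.mem_powersetCard.1 hA).2, ← sum_gnpWeight_isIndepSet]
  rw [Finset.sum_congr rfl h, Finset.sum_const, Finset.card_powersetCard, Finset.card_univ,
    Fintype.card_fin, nsmul_eq_mul, muNat]

/-- The expected number of independent `a`-sets meeting a given one in `j` points. -/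
noncomputable def overlapTerm (n a : ℕ) (q : ℝ) (j : ℕ) : ℝ :=
  (a.choose j : ℝ) * ((n - a).choose (a - j) : ℝ) * q ^ (a.choose 2 - j.choose 2)

theorem sum_gnpWeight_mul_indepCount_sq_le (n a : ℕ) {p : ℝ} (hp1 : p < 1) :
    ∑ G : SimpleGraph (Fin n), gnpWeight n p G * indepCount a G ^ 2
      ≤ muNat n a (1 - p) ^ 2 + muNat n a (1 - p) *
        (1 + ∑ j ∈ Finset.Ico 2 a, overlapTerm n a (1 - p) j) := by
  classical
  set q := 1 - p with hq
  have hq0 : 0 ≤ q := by linarith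
  set S := (Finset.univ : Finset (Fin n)).powersetCard a with hS
  have hScard : S.card = n.choose a := by
    rw [hS, Finset.card_powersetCard, Finset.card_univ, Fintype.card_fin]
  have hsq : ∀ G : SimpleGraph (Fin n), gnpWeight n p G * indepCount a G ^ 2 =
      ∑ A ∈ S, ∑ B ∈ S, if G.IsIndepSet A ∧ G.IsIndepSet B then gnpWeight n p G else 0 := by
    intro G
    rw [indepCount, sq, Finset.sum_mul_sum, Finset.mul_sum]
    refine Finset.sum_congr rfl fun A _ => ?_
    rw [Finset.mul_sum]
    refine Finset.sum_congr rfl fun B _ => ?_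
    by_cases h1 : G.IsIndepSet A <;> by_cases h2 : G.IsIndepSet B <;> simp [h1, h2]
  have hA : ∀ A ∈ S, ∑ B ∈ S, q ^ (A.card.choose 2 + B.card.choose 2 - (A ∩ B).card.choose 2)
      ≤ (n.choose a : ℝ) * q ^ (a.choose 2 + a.choose 2)
        + q ^ a.choose 2 * ∑ j ∈ Finset.Icc 2 a, overlapTerm n a q j := by
    intro A hA
    have hAc : A.card = a := (Finset.mem_powersetCard.1 hA).2
    have hB : ∀ B ∈ S, q ^ (A.card.choose 2 + B.card.choose 2 - (A ∩ B).card.choose 2)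
        ≤ q ^ (a.choose 2 + a.choose 2) + ∑ j ∈ Finset.Icc 2 a,
          if (A ∩ B).card = j then q ^ (a.choose 2 + a.choose 2 - j.choose 2) else 0 := by
      intro B hB
      rw [hAc, (Finset.mem_powersetCard.1 hB).2, Finset.sum_ite_eq]
      have hle : (A ∩ B).card ≤ a := hAc ▸ Finset.card_le_card Finset.inter_subset_left
      split_ifs with h
      · exact le_add_of_nonneg_left (by positivity)
      · have hz : (A ∩ B).card.choose 2 = 0 :=
          Nat.choose_eq_zero_of_lt (by rw [Finset.mem_Icc] at h; omega)
        rw [hz, Nat.sub_zero, add_zero]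
    refine (Finset.sum_le_sum hB).trans ?_
    rw [Finset.sum_add_distrib, Finset.sum_const, hScard, nsmul_eq_mul, Finset.sum_comm,
      Finset.mul_sum]
    gcongr with j hj
    rw [← Finset.sum_filter, Finset.sum_const, nsmul_eq_mul, overlapTerm, Nat.add_sub_assoc
      (Nat.choose_le_choose 2 (Finset.mem_Icc.1 hj).2), pow_add]
    have hcard := card_powersetCard_inter_le (j := j) A hAc
    rw [← hS] at hcard
    calc _ ≤ ((a.choose j * (n - a).choose (a - j) : ℕ) : ℝ) *
          (q ^ a.choose 2 * q ^ (a.choose 2 - j.choose 2)) := by gcongr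
      _ = _ := by push_cast; ring
  have hIcc : ∑ j ∈ Finset.Icc 2 a, overlapTerm n a q j
      ≤ 1 + ∑ j ∈ Finset.Ico 2 a, overlapTerm n a q j := by
    rcases le_or_gt 2 a with h | h
    · rw [← Finset.Ico_insert_right h, Finset.sum_insert Finset.right_notMem_Ico]
      simp [overlapTerm]
    · rw [Finset.Icc_eq_empty (by omega), Finset.Ico_eq_empty (by omega)]
      simp
  simp_rw [hsq]
  rw [Finset.sum_comm]
  calc _ = ∑ A ∈ S, ∑ B ∈ S,
        q ^ (A.card.choose 2 + B.card.choose 2 - (A ∩ B).card.choose 2) := by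
        refine Finset.sum_congr rfl fun A _ => ?_
        rw [Finset.sum_comm]
        exact Finset.sum_congr rfl fun B _ => by rw [sum_gnpWeight_isIndepSet_pair]
    _ ≤ ∑ A ∈ S, ((n.choose a : ℝ) * q ^ (a.choose 2 + a.choose 2)
        + q ^ a.choose 2 * ∑ j ∈ Finset.Icc 2 a, overlapTerm n a q j) := Finset.sum_le_sum hA
    _ = muNat n a q ^ 2 + muNat n a q * ∑ j ∈ Finset.Icc 2 a, overlapTerm n a q j := by
        rw [Finset.sum_const, hScard, nsmul_eq_mul, muNat, pow_add]
        ring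
    _ ≤ _ := by
        have : 0 ≤ muNat n a q := by unfold muNat; positivity
        gcongr

/-- The planted-independent-set coupling. -/
theorem exists_coupling_of_overlap_le {n a : ℕ} {p c : ℝ} (hp0 : 0 < p) (hp1 : p < 1)
    (ha : a ≤ n) (hc : 0 < c)
    (h : 1 + ∑ j ∈ Finset.Ico 2 a, overlapTerm n a (1 - p) j ≤ c ^ 2) :
    ∃ κ : Coupling p (n - a) n, 1 - c / (2 * √(muNat n a (1 - p)))
      ≤ couplingProb κ {x | chrom x.2 ≤ chrom x.1 + 1} := by
  classical
  have hq : 0 < 1 - p := by linarith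
  set μ := muNat n a (1 - p) with hμdef
  have hμ : 0 < μ := by
    have := Nat.choose_pos ha
    rw [hμdef, muNat]; positivity
  set S := (Finset.univ : Finset (Fin n)).powersetCard a with hS
  have hemb : ∀ A : Finset (Fin n), ∃ e : Fin (n - a) ↪ Fin n,
      A.card = a → Set.range e = (A : Set (Fin n))ᶜ := by
    intro A
    by_cases hA : A.card = a
    · have h2 : (Aᶜ).card = n - a := by rw [Finset.card_compl, hA, Fintype.card_fin]
      refine ⟨((Aᶜ).orderEmbOfFin h2).toEmbedding, fun _ => ?_⟩
      simp
    · exact ⟨Fin.castLEEmb (Nat.sub_le n a), fun h => absurd h hA⟩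
  choose e he using hemb
  let N : SimpleGraph (Fin (n - a)) → SimpleGraph (Fin n) → ℝ := fun H G =>
    ∑ A ∈ S, if G.IsIndepSet A ∧ G.comap (e A) = H then 1 else 0
  have hN0 : ∀ H G, 0 ≤ N H G := fun H G => Finset.sum_nonneg fun A _ => by
    split_ifs <;> norm_num
  have hNsum : ∀ G, ∑ H, N H G = indepCount a G := by
    intro G
    rw [Finset.sum_comm, indepCount]
    refine Finset.sum_congr rfl fun A _ => ?_
    by_cases hA : G.IsIndepSet A <;> simp [hA]
  have hNw : ∀ H, ∑ G, gnpWeight n p G * N H G = μ * gnpWeight (n - a) p H := by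
    intro H
    simp_rw [N, Finset.mul_sum, mul_ite, mul_one, mul_zero]
    rw [Finset.sum_comm]
    have h1 : ∀ A ∈ S, ∑ G : SimpleGraph (Fin n),
        (if G.IsIndepSet A ∧ G.comap (e A) = H then gnpWeight n p G else 0)
          = (1 - p) ^ a.choose 2 * gnpWeight (n - a) p H := by
      intro A hA
      have hAc := (Finset.mem_powersetCard.1 hA).2
      rw [sum_gnpWeight_isIndepSet_comap A (e A) (he A hAc), hAc]
    rw [Finset.sum_congr rfl h1, Finset.sum_const, hS, Finset.card_powersetCard,
      Finset.card_univ, Fintype.card_fin, nsmul_eq_mul, hμdef, muNat]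
    ring
  have hNchrom : ∀ H G, N H G ≠ 0 → chrom G ≤ chrom H + 1 := by
    intro H G hN
    obtain ⟨A, hA, hne⟩ := Finset.exists_ne_zero_of_sum_ne_zero hN
    have hAc := (Finset.mem_powersetCard.1 hA).2
    obtain ⟨h1, rfl⟩ : G.IsIndepSet A ∧ G.comap (e A) = H := by
      by_contra hcon
      exact hne (if_neg hcon)
    exact chrom_le_of_isIndepSet G A h1 (e A) (he A hAc)
  have hw := gnpWeight_nonneg (n := n) hp0.le hp1.le
  have hmax : ∀ G : SimpleGraph (Fin n), 0 < max μ (indepCount a G) :=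
    fun G => lt_max_of_lt_left hμ
  let s : SimpleGraph (Fin (n - a)) → SimpleGraph (Fin n) → ℝ := fun H G =>
    gnpWeight n p G * (N H G / max μ (indepCount a G))
  have hs0 : ∀ H G, 0 ≤ s H G := fun H G =>
    mul_nonneg (hw G) (div_nonneg (hN0 H G) (hmax G).le)
  have hsG : ∀ G, ∑ H, s H G = gnpWeight n p G * (indepCount a G / max μ (indepCount a G)) := by
    intro G
    rw [← Finset.mul_sum, ← Finset.sum_div, hNsum]
  obtain ⟨κ, hκs, hκ0, hκ1, hκ2⟩ := exists_coupling_ge (gnpWeight (n - a) p) (gnpWeight n p)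
    (sum_gnpWeight _ p) (sum_gnpWeight _ p) s hs0
    (by
      intro H
      calc ∑ G, s H G ≤ ∑ G, gnpWeight n p G * (N H G / μ) := by
            refine Finset.sum_le_sum fun G _ => mul_le_mul_of_nonneg_left ?_ (hw G)
            exact div_le_div_of_nonneg_left (hN0 H G) hμ (le_max_left _ _)
        _ = gnpWeight (n - a) p H := by
            simp_rw [← mul_div_assoc]
            rw [← Finset.sum_div, hNw]
            field_simp)
    (by
      intro G
      rw [hsG]
      exact mul_le_of_le_one_right (hw G) ((div_le_one (hmax G)).2 (le_max_right _ _)))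
  refine ⟨⟨fun x => κ x.1 x.2, fun x => hκ0 _ _, hκ1, hκ2⟩, ?_⟩
  have hbound := one_sub_le_sum_div_max (gnpWeight n p) (indepCount a) hw (sum_gnpWeight n p) hμ
    hc (sum_gnpWeight_mul_indepCount n a p)
    ((sum_gnpWeight_mul_indepCount_sq_le n a hp1).trans (by gcongr))
  refine hbound.trans ?_
  rw [couplingProb, Fintype.sum_prod_type, Finset.sum_comm]
  refine Finset.sum_le_sum fun G _ => ?_
  rw [← hsG]
  refine Finset.sum_le_sum fun H _ => ?_
  split_ifs with hmem
  · exact hκs H G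
  · have hzero : N H G = 0 := by
      by_contra hne
      exact hmem (hNchrom H G hne)
    simp [s, hzero]

theorem descFactorial_mul_pow_le {n a : ℕ} (h : a ≤ n) (j : ℕ) :
    a.descFactorial j * n ^ j ≤ a ^ j * n.descFactorial j := by
  induction j with
  | zero => simp
  | succ k ih =>
    rw [Nat.descFactorial_succ, Nat.descFactorial_succ, pow_succ, pow_succ]
    have h1 : (a - k) * n ≤ a * (n - k) := by
      rw [Nat.sub_mul, Nat.mul_sub, mul_comm a k]
      exact Nat.sub_le_sub_left (Nat.mul_le_mul_left k h) _
    calc (a - k) * a.descFactorial k * (n ^ k * n)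
        = (a - k) * n * (a.descFactorial k * n ^ k) := by ring
      _ ≤ a * (n - k) * (a ^ k * n.descFactorial k) := Nat.mul_le_mul h1 ih
      _ = _ := by ring

theorem choose_mul_choose_mul_pow_le {n a j : ℕ} (h : a ≤ n) (hj : j ≤ a) :
    a.choose j * (n - a).choose (a - j) * n ^ j ≤ n.choose a * (a ^ 2) ^ j := by
  have h1 : a.choose j * n ^ j ≤ a ^ j * n.choose j := by
    have := descFactorial_mul_pow_le h j
    rw [Nat.descFactorial_eq_factorial_mul_choose, Nat.descFactorial_eq_factorial_mul_choose]
      at this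
    refine Nat.le_of_mul_le_mul_left ?_ j.factorial_pos
    linarith
  have h2 : (n - j).choose (a - j) * n ^ j ≤ n.choose a * a ^ j := by
    refine Nat.le_of_mul_le_mul_left ?_ (Nat.choose_pos (hj.trans h))
    calc n.choose j * ((n - j).choose (a - j) * n ^ j)
        = n.choose a * (a.choose j * n ^ j) := by
          rw [← mul_assoc, ← Nat.choose_mul hj, mul_assoc]
      _ ≤ n.choose a * (a ^ j * n.choose j) := Nat.mul_le_mul_left _ h1
      _ = _ := by ring
  calc a.choose j * (n - a).choose (a - j) * n ^ j
      ≤ a ^ j * (n - j).choose (a - j) * n ^ j := by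
        gcongr
        exact Nat.choose_le_pow a j
    _ = a ^ j * ((n - j).choose (a - j) * n ^ j) := by ring
    _ ≤ a ^ j * (n.choose a * a ^ j) := Nat.mul_le_mul_left _ h2
    _ = _ := by rw [← pow_mul, mul_comm 2 j, pow_mul]; ring

theorem two_mul_choose_two (j : ℕ) : 2 * j.choose 2 = j * (j - 1) := by
  rw [Nat.choose_two_right, Nat.mul_div_cancel' (Nat.even_mul_pred_self j).two_dvd]

/-- Each overlap term is small, in terms of `s = √q`, `r = √n` and `y` a small power of `n`. -/
theorem overlapTerm_le {n a j : ℕ} {s r y δ : ℝ} (hs0 : 0 < s) (hs1 : s < 1) (hr : 1 ≤ r)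
    (hy : 1 ≤ y) (hyr : y ≤ r) (hn : (n : ℝ) = r ^ 2) (hsa : s ^ a * (r * y) ≤ 1)
    (hμ : muNat n a (s ^ 2) * y ^ 2 ≤ r ^ 4) (ha : (a : ℝ) ^ 10 ≤ δ * (y * s ^ 12))
    (hδ0 : 0 ≤ δ) (hδ : δ ≤ 1) (han : a ≤ n) (hj2 : 2 ≤ j) (hja : j < a) :
    overlapTerm n a (s ^ 2) j ≤ δ := by
  have ha1 : (1 : ℝ) ≤ a := by exact_mod_cast (by omega : 1 ≤ a)
  have hy0 : 0 < y := by linarith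
  have hr0 : 0 < r := by linarith
  have hs12 : s ^ 12 ≤ 1 := pow_le_one₀ hs0.le hs1.le
  have hay : (a : ℝ) ^ 10 ≤ δ * y := by
    refine ha.trans (mul_le_mul_of_nonneg_left ?_ hδ0)
    exact mul_le_of_le_one_right hy0.le hs12
  have ha2 : (a : ℝ) ^ 2 ≤ r := by
    calc (a : ℝ) ^ 2 ≤ (a : ℝ) ^ 10 := pow_le_pow_right₀ ha1 (by norm_num)
      _ ≤ δ * y := hay
      _ ≤ 1 * r := by gcongr
      _ = r := one_mul r
  set T := overlapTerm n a (s ^ 2) j with hT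
  have hT0 : 0 ≤ T := by rw [hT, overlapTerm]; positivity
  have hmain : T * (r ^ 2) ^ j * s ^ (j * (j - 1)) * y ^ 2 ≤ r ^ 4 * ((a : ℝ) ^ 2) ^ j := by
    have h1 : ((a.choose j * (n - a).choose (a - j) * n ^ j : ℕ) : ℝ)
        ≤ (n.choose a * (a ^ 2) ^ j : ℕ) := Nat.cast_le.2 (choose_mul_choose_mul_pow_le han hja.le)
    push_cast at h1
    have h2 : (s ^ 2) ^ (a.choose 2 - j.choose 2) * s ^ (j * (j - 1))
        = (s ^ 2) ^ a.choose 2 := by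
      rw [← two_mul_choose_two, pow_mul s 2, ← pow_add,
        Nat.sub_add_cancel (Nat.choose_le_choose 2 hja.le)]
    calc T * (r ^ 2) ^ j * s ^ (j * (j - 1)) * y ^ 2
        = (a.choose j * (n - a).choose (a - j) * (n : ℝ) ^ j) * (((s ^ 2) ^
          (a.choose 2 - j.choose 2) * s ^ (j * (j - 1))) * y ^ 2) := by
          rw [hT, overlapTerm, hn]; ring
      _ ≤ (n.choose a * ((a : ℝ) ^ 2) ^ j) * ((s ^ 2) ^ a.choose 2 * y ^ 2) := by
          rw [h2]; gcongr
      _ = (muNat n a (s ^ 2) * y ^ 2) * ((a : ℝ) ^ 2) ^ j := by rw [muNat]; ring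
      _ ≤ _ := by gcongr
  rcases le_or_gt j 4 with hj4 | hj4
  · obtain ⟨k, rfl⟩ := Nat.exists_eq_add_of_le hj2
    have hk : ((a : ℝ) ^ 2) ^ k ≤ (r ^ 2) ^ k :=
      pow_le_pow_left₀ (by positivity) (ha2.trans (le_self_pow₀ hr two_ne_zero)) k
    have hs : s ^ 12 ≤ s ^ ((2 + k) * (2 + k - 1)) := by
      refine pow_le_pow_of_le_one hs0.le hs1.le ?_
      calc (2 + k) * (2 + k - 1) ≤ 4 * 3 := Nat.mul_le_mul hj4 (by omega)
        _ = 12 := rfl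
    have hpos : 0 < r ^ 4 * (r ^ 2) ^ k * (s ^ 12 * y) := by positivity
    refine le_of_mul_le_mul_right ?_ hpos
    calc T * (r ^ 4 * (r ^ 2) ^ k * (s ^ 12 * y))
        = T * (r ^ 2) ^ (2 + k) * s ^ 12 * (y * 1) := by ring
      _ ≤ T * (r ^ 2) ^ (2 + k) * s ^ ((2 + k) * (2 + k - 1)) * (y * y) := by gcongr
      _ = T * (r ^ 2) ^ (2 + k) * s ^ ((2 + k) * (2 + k - 1)) * y ^ 2 := by ring
      _ ≤ r ^ 4 * ((a : ℝ) ^ 2) ^ (2 + k) := hmain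
      _ = r ^ 4 * ((a : ℝ) ^ 2) ^ k * (a : ℝ) ^ 4 := by ring
      _ ≤ r ^ 4 * (r ^ 2) ^ k * (a : ℝ) ^ 10 := by
          gcongr ?_ * ?_ * ?_
          exact pow_le_pow_right₀ ha1 (by norm_num)
      _ ≤ r ^ 4 * (r ^ 2) ^ k * (δ * (y * s ^ 12)) := by gcongr
      _ = _ := by ring
  rcases le_or_gt 1 (s ^ j * r) with hsj | hsj
  · obtain ⟨k, rfl⟩ := Nat.exists_eq_add_of_le (show 5 ≤ j by omega)
    have hbase : r ≤ r ^ 2 * s ^ (5 + k - 1) := by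
      calc r = 1 * r := (one_mul r).symm
        _ ≤ s ^ (5 + k) * r * r := by gcongr
        _ ≤ s ^ (5 + k - 1) * r * r := by
            gcongr ?_ * _ * _
            exact pow_le_pow_of_le_one hs0.le hs1.le (Nat.sub_le _ _)
        _ = _ := by ring
    have hpos : 0 < r ^ 5 * r ^ k * y := by positivity
    refine le_of_mul_le_mul_right ?_ hpos
    calc T * (r ^ 5 * r ^ k * y) = T * r ^ (5 + k) * (y * 1) := by ring
      _ ≤ T * (r ^ 2 * s ^ (5 + k - 1)) ^ (5 + k) * (y * y) := by gcongr
      _ = T * (r ^ 2) ^ (5 + k) * s ^ ((5 + k) * (5 + k - 1)) * y ^ 2 := by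
          rw [mul_pow, ← pow_mul s, mul_comm (5 + k - 1)]; ring
      _ ≤ r ^ 4 * ((a : ℝ) ^ 2) ^ (5 + k) := hmain
      _ = r ^ 4 * ((a : ℝ) ^ 2) ^ k * (a : ℝ) ^ 10 := by ring
      _ ≤ r ^ 4 * r ^ k * (δ * y) := by gcongr
      _ ≤ r ^ 4 * r ^ k * (δ * y) * r := le_mul_of_one_le_right (by positivity) hr
      _ = _ := by ring
  · obtain ⟨i, rfl⟩ := Nat.exists_eq_add_of_lt hja
    have hexp : (s ^ 2) ^ ((j + i + 1).choose 2 - j.choose 2)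
        = (s ^ ((j + i + 1) + j - 1)) ^ (i + 1) := by
      rw [← pow_mul, ← pow_mul, Nat.mul_sub, two_mul_choose_two, two_mul_choose_two]
      congr 1
      obtain ⟨k, rfl⟩ := Nat.exists_eq_add_of_le' (show 1 ≤ j by omega)
      rw [show k + 1 + i + 1 - 1 = k + 1 + i by omega, show k + 1 - 1 = k by omega,
        show k + 1 + i + 1 + (k + 1) - 1 = 2 * k + i + 2 by omega]
      refine Nat.sub_eq_of_eq_add ?_
      ring
    have hsub : (j + i + 1) - j = i + 1 := by omega
    have hc1 : (((j + i + 1).choose j : ℕ) : ℝ) ≤ ((j + i + 1 : ℕ) : ℝ) ^ (i + 1) := by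
      rw [← Nat.choose_symm hja.le, hsub]
      exact_mod_cast Nat.choose_le_pow _ _
    have hc2 : (((n - (j + i + 1)).choose (i + 1) : ℕ) : ℝ) ≤ (r ^ 2) ^ (i + 1) := by
      rw [← hn]
      exact_mod_cast (Nat.choose_le_pow _ _).trans (Nat.pow_le_pow_left (Nat.sub_le _ _) _)
    set A : ℝ := ((j + i + 1 : ℕ) : ℝ) with hA
    set x : ℝ := A * r ^ 2 * s ^ ((j + i + 1) + j - 1) with hx
    have hx0 : 0 ≤ x := by positivity
    have hxδ : x ≤ δ := by
      have hpos : 0 < s * y := by positivity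
      refine le_of_mul_le_mul_right ?_ hpos
      calc x * (s * y) = A * (s ^ (j + i + 1) * (r * y)) * (s ^ j * r) := by
            have hpow : s ^ ((j + i + 1) + j - 1) * s = s ^ (j + i + 1) * s ^ j := by
              rw [← pow_succ, ← pow_add]
              congr 1
              omega
            calc x * (s * y) = A * r ^ 2 * y * (s ^ ((j + i + 1) + j - 1) * s) := by
                  rw [hx]; ring
              _ = _ := by rw [hpow]; ring
        _ ≤ A * 1 * 1 := by gcongr
        _ ≤ A ^ 10 := by
            rw [mul_one, mul_one]
            exact le_self_pow₀ ha1 (by norm_num)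
        _ ≤ δ * (y * s ^ 12) := ha
        _ ≤ δ * (y * s) := by
            gcongr
            exact pow_le_of_le_one hs0.le hs1.le (by norm_num)
        _ = _ := by ring
    calc T ≤ A ^ (i + 1) * (r ^ 2) ^ (i + 1) * (s ^ ((j + i + 1) + j - 1)) ^ (i + 1) := by
          rw [hT, overlapTerm, hexp, hsub]
          gcongr
      _ = x ^ (i + 1) := by rw [hx, mul_pow, mul_pow]
      _ ≤ x := pow_le_of_le_one hx0 (hxδ.trans hδ) (by omega)
      _ ≤ δ := hxδ

theorem eventually_mul_log_pow_le (K : ℝ) {C : ℝ} (hC : 0 < C) :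
    ∀ᶠ n : ℕ in atTop, (K * Real.log n) ^ 11 ≤ C * (n : ℝ) ^ (0.005 : ℝ) := by
  have h := (isLittleO_log_rpow_rpow_atTop 11 (show (0 : ℝ) < 0.005 by norm_num)).const_mul_left
    (K ^ 11)
  have h2 := tendsto_natCast_atTop_atTop.eventually (h.bound hC)
  filter_upwards [h2] with n hn
  rw [Real.norm_eq_abs, Real.norm_eq_abs, abs_of_nonneg (Real.rpow_nonneg n.cast_nonneg _),
    show (11 : ℝ) = ((11 : ℕ) : ℝ) by norm_num, Real.rpow_natCast, ← mul_pow] at hn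
  exact (le_abs_self _).trans hn

theorem eventually_sum_overlapTerm_le {p : ℝ} (hp0 : 0 < p) (hp1 : p < 1) {ε : ℝ} (hε : 0 < ε) :
    ∀ᶠ n : ℕ in atTop, ∀ a : ℕ, 1.01 * Real.logb (1 / (1 - p)) n ≤ (a : ℝ) →
      (a : ℝ) ≤ 100 * Real.logb (1 / (1 - p)) n →
      muNat n a (1 - p) ≤ (n : ℝ) ^ (1.99 : ℝ) →
      a ≤ n ∧ ∑ j ∈ Finset.Ico 2 a, overlapTerm n a (1 - p) j ≤ ε := by
  set q := 1 - p with hq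
  have hq0 : 0 < q := by linarith
  have hq1 : q < 1 := by linarith
  set s := √q with hs
  have hs0 : 0 < s := Real.sqrt_pos.2 hq0
  have hsq : s ^ 2 = q := Real.sq_sqrt hq0.le
  have hs1 : s < 1 := by
    rw [hs, Real.sqrt_lt' one_pos]; linarith
  set η := min ε 1 with hη
  have hη0 : 0 < η := lt_min hε one_pos
  have hlogq : Real.log q < 0 := Real.log_neg hq0 hq1
  have hlogb : ∀ x : ℝ, Real.logb (1 / q) x = Real.log x / -Real.log q := by
    intro x
    rw [Real.logb, one_div, Real.log_inv]
  filter_upwards [eventually_mul_log_pow_le (100 / -Real.log q)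
    (show 0 < η * s ^ 12 by positivity), eventually_ge_atTop 1] with n hlog hn1 a ha1 ha2 hμ
  rw [hlogb] at ha1 ha2
  have hnR : (1 : ℝ) ≤ n := by exact_mod_cast hn1
  have hn0 : (0 : ℝ) < n := by linarith
  set y := (n : ℝ) ^ (0.005 : ℝ) with hy
  set r := √(n : ℝ) with hr
  have hrn : r = (n : ℝ) ^ (0.5 : ℝ) := by
    rw [hr, Real.sqrt_eq_rpow]; norm_num
  have hr2 : (n : ℝ) = r ^ 2 := (Real.sq_sqrt hn0.le).symm
  have hy1 : 1 ≤ y := Real.one_le_rpow hnR (by norm_num)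
  have hyr : y ≤ r := by
    rw [hrn]; exact Real.rpow_le_rpow_of_exponent_le hnR (by norm_num)
  have hr1 : 1 ≤ r := hy1.trans hyr
  have ha11 : (a : ℝ) ^ 11 ≤ η * s ^ 12 * y := by
    refine le_trans ?_ hlog
    gcongr
    refine ha2.trans_eq ?_
    ring
  have hs12 : s ^ 12 ≤ 1 := pow_le_one₀ hs0.le hs1.le
  have han : a ≤ n := by
    rcases Nat.eq_zero_or_pos a with h0 | h0
    · omega
    have h1 : (1 : ℝ) ≤ a := by exact_mod_cast h0
    have : (a : ℝ) ≤ n := by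
      calc (a : ℝ) ≤ (a : ℝ) ^ 11 := le_self_pow₀ h1 (by norm_num)
        _ ≤ η * s ^ 12 * y := ha11
        _ ≤ 1 * 1 * r := by
            gcongr
            exact min_le_right _ _
        _ ≤ r * r := by rw [one_mul]; gcongr
        _ = n := by rw [hr2]; ring
    exact_mod_cast this
  refine ⟨han, ?_⟩
  have hsa : s ^ a * (r * y) ≤ 1 := by
    have h1 : s ^ a = Real.exp (Real.log q / 2 * a) := by
      rw [hs, ← Real.log_sqrt hq0.le, mul_comm, Real.exp_nat_mul, Real.exp_log hs0]
    have h2 : r * y = Real.exp (0.505 * Real.log n) := by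
      rw [hrn, hy, ← Real.rpow_add hn0, Real.rpow_def_of_pos hn0, mul_comm]
      norm_num
    rw [h1, h2, ← Real.exp_add, Real.exp_le_one_iff]
    rw [← mul_div_assoc, div_le_iff₀ (by linarith)] at ha1
    linarith
  have hμ' : muNat n a (s ^ 2) * y ^ 2 ≤ r ^ 4 := by
    rw [hsq]
    calc muNat n a q * y ^ 2 ≤ (n : ℝ) ^ (1.99 : ℝ) * y ^ 2 := by gcongr
      _ = (n : ℝ) ^ (2 : ℕ) := by
          rw [hy, ← Real.rpow_mul_natCast hn0.le, ← Real.rpow_add hn0, ← Real.rpow_natCast]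
          norm_num
      _ = r ^ 4 := by rw [hr2]; ring
  rcases le_or_gt a 1 with ha | ha
  · rw [Finset.Ico_eq_empty (by omega), Finset.sum_empty]
    exact hε.le
  have haR : (1 : ℝ) ≤ a := by exact_mod_cast ha.le
  have haR0 : (0 : ℝ) < a := by linarith
  have hle : ∀ j ∈ Finset.Ico 2 a, overlapTerm n a q j ≤ η / a := by
    intro j hj
    rw [Finset.mem_Ico] at hj
    rw [← hsq]
    refine overlapTerm_le hs0 hs1 hr1 hy1 hyr hr2 hsa hμ' ?_ (by positivity) ?_ han hj.1 hj.2
    · rw [div_mul_eq_mul_div, le_div_iff₀ haR0]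
      calc (a : ℝ) ^ 10 * a = (a : ℝ) ^ 11 := by ring
        _ ≤ η * s ^ 12 * y := ha11
        _ = _ := by ring
    · exact (div_le_one haR0).2 ((min_le_right _ _).trans haR)
  calc ∑ j ∈ Finset.Ico 2 a, overlapTerm n a q j ≤ ∑ j ∈ Finset.Ico 2 a, η / a :=
        Finset.sum_le_sum hle
    _ = ((a - 2 : ℕ) : ℝ) * (η / a) := by
        rw [Finset.sum_const, Nat.card_Ico, nsmul_eq_mul]
    _ ≤ a * (η / a) := by
        gcongr
        exact Nat.sub_le _ _
    _ = η := by field_simp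
    _ ≤ ε := min_le_left _ _

/-- **coupling lemma.** Let `p ∈ (0,1)` and `b = 1/(1-p)`.  For every `ε > 0`
there is `n₀` such that for all `n ≥ n₀` and all integers `a` with
`1.01 log_b n ≤ a ≤ 100 log_b n` and `μ ≤ n^{1.99}` (where `μ = C(n,a)(1-p)^C(a,2)`),
there is a coupling of `G_{n-a,p}` and `G_{n,p}` with
`P(χ(G_n) ≤ χ(G_{n-a}) + 1) ≥ 1 − (1+ε)/(2√μ)`. -/
theorem coupling_lemma (p : ℝ) (hp0 : 0 < p) (hp1 : p < 1) :
    ∀ ε : ℝ, 0 < ε → ∃ n₀ : ℕ, ∀ n : ℕ, n₀ ≤ n → ∀ a : ℕ,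
      1.01 * Real.logb (1 / (1 - p)) n ≤ (a : ℝ) →
      (a : ℝ) ≤ 100 * Real.logb (1 / (1 - p)) n →
      muNat n a (1 - p) ≤ (n : ℝ) ^ (1.99 : ℝ) →
      ∃ c : Coupling p (n - a) n,
        1 - (1 + ε) / (2 * Real.sqrt (muNat n a (1 - p)))
          ≤ couplingProb c {x | chrom x.2 ≤ chrom x.1 + 1} := by
  intro ε hε
  obtain ⟨n₀, hn₀⟩ := eventually_atTop.1 (eventually_sum_overlapTerm_le hp0 hp1 hε)
  refine ⟨n₀, fun n hn a ha1 ha2 hμ => ?_⟩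
  obtain ⟨han, hsum⟩ := hn₀ n hn a ha1 ha2 hμ
  refine exists_coupling_of_overlap_le hp0 hp1 han (by linarith) ?_
  nlinarith
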